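/- Asymptotically almost surely, m_A = m_Z; that is, with probability tending to 1 as n → ∞, the first time m in the random digraph process at which D(n,m) has at most one vertex of in-degree zero is exactly the first time at which D(n,m) contains a spanning arborescence. -/

import Mathlib

open Filter

/-- The directed edges of the complete digraph on `Fin n`:
ordered pairs `(tail, head)` of distinct vertices. -/
abbrev DEdge (n : ℕ) := {e : Fin n × Fin n // e.1 ≠ e.2}

/-- `ε(n) = log log n / log n`. -/
noncomputable def eps (n : ℕ) : ℝ := Real.log (Real.log n) / Real.log n

/-- The number of available colours: `⌊(1 + 50 ε) n⌋`. -/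
noncomputable def numColours (n : ℕ) : ℕ := ⌊(1 + 50 * eps n) * n⌋₊

/-- The set of colours `W`. -/
abbrev Colour (n : ℕ) := Fin (numColours n)

/-- The sample space of the coloured random digraph process: a uniformly random
permutation of the edges (determining the random ordering `e₁, …, e_N`) together
with a uniformly random colouring of the edges. -/
abbrev SampleSpace (n : ℕ) := Equiv.Perm (DEdge n) × (DEdge n → Colour n)

/-- The (0-indexed) position of edge `e` in the random ordering determined by `ω`. -/
noncomputable def edgePos {n : ℕ} (ω : SampleSpace n) (e : DEdge n) : ℕ :=
  ((Fintype.equivFin (DEdge n)) (ω.1 e)).val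

/-- `e` is one of the first `m` edges of the process, i.e. an edge of `D(n,m)`. -/
def inProcess {n : ℕ} (ω : SampleSpace n) (m : ℕ) (e : DEdge n) : Prop :=
  edgePos ω e < m

/-- The probability of an event under the uniform measure on a finite sample space. -/
noncomputable def prob {Ω : Type*} [Fintype Ω] (p : Ω → Prop) : ℝ :=
  (Nat.card {ω : Ω // p ω} : ℝ) / (Fintype.card Ω : ℝ)

/-- Vertex `v` has in-degree zero in `D(n,m)`. -/
def InDegreeZero {n : ℕ} (ω : SampleSpace n) (m : ℕ) (v : Fin n) : Prop :=
  ∀ e : DEdge n, inProcess ω m e → e.val.2 ≠ v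

/-- The event `Z_m`: at most one vertex of `D(n,m)` has in-degree zero. -/
def ZEvent {n : ℕ} (ω : SampleSpace n) (m : ℕ) : Prop :=
  Set.Subsingleton {v : Fin n | InDegreeZero ω m v}

/-- `A` is the edge set of a spanning arborescence rooted at `u`: the root has no
in-edge, every other vertex has exactly one in-edge, and every vertex is reachable
from the root along edges of `A` (equivalently, for every vertex `v` there is
exactly one directed path from `u` to `v`). -/
def IsSpanningArborescence {n : ℕ} (A : Set (DEdge n)) (u : Fin n) : Prop :=
  (∀ e ∈ A, (e : DEdge n).val.2 ≠ u) ∧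
  (∀ v : Fin n, v ≠ u → ∃! e : DEdge n, e ∈ A ∧ e.val.2 = v) ∧
  (∀ v : Fin n, Relation.ReflTransGen (fun x y => ∃ e ∈ A, (e : DEdge n).val = (x, y)) u v)

/-- The event `A_m`: `D(n,m)` contains a spanning arborescence. -/
def AEvent {n : ℕ} (ω : SampleSpace n) (m : ℕ) : Prop :=
  ∃ (u : Fin n) (A : Set (DEdge n)), (∀ e ∈ A, inProcess ω m e) ∧ IsSpanningArborescence A u

/-- The event `R_m`: `D(n,m)` contains a rainbow spanning arborescence. -/
def REvent {n : ℕ} (ω : SampleSpace n) (m : ℕ) : Prop :=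
  ∃ (u : Fin n) (A : Set (DEdge n)), (∀ e ∈ A, inProcess ω m e) ∧
    IsSpanningArborescence A u ∧ Set.InjOn ω.2 A

/-- The hitting time `min {m : P m}`, with the convention `min ∅ = N = n(n-1)`. -/
noncomputable def hitTime (n : ℕ) (P : ℕ → Prop) : ℕ :=
  sInf ({m | P m} ∪ {n * (n - 1)})

open Equiv in
theorem exists_perm_map_embedding {ι E : Type*} [Finite ι] [Finite E] (g g' : ι ↪ E) :
    ∃ τ : Perm E, ∀ a, τ (g a) = g' a := by
  classical
  have := Fintype.ofFinite E
  let e : {x // x ∈ Set.range g} ≃ {x // x ∈ Set.range g'} :=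
    (Equiv.ofInjective g g.injective).symm.trans (Equiv.ofInjective g' g'.injective)
  refine ⟨e.extendSubtype, fun a => ?_⟩
  rw [Equiv.extendSubtype_apply_of_mem e (g a) ⟨a, rfl⟩]
  have h : (Equiv.ofInjective g g.injective).symm ⟨g a, ⟨a, rfl⟩⟩ = a :=
    Equiv.ofInjective_symm_apply g.injective a
  simp [e, h]

section Prob

variable {Ω : Type*} [Fintype Ω]

theorem prob_eq_card_filter (p : Ω → Prop) [DecidablePred p] :
    prob p = ((Finset.univ.filter p).card : ℝ) / (Fintype.card Ω : ℝ) := by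
  rw [prob, Nat.card_eq_fintype_card, Fintype.card_subtype]

theorem prob_nonneg (p : Ω → Prop) : 0 ≤ prob p := by
  unfold prob; positivity

theorem prob_mono {p q : Ω → Prop} (h : ∀ ω, p ω → q ω) : prob p ≤ prob q := by
  classical
  rw [prob_eq_card_filter, prob_eq_card_filter]
  gcongr
  exact h _

theorem prob_le_one (p : Ω → Prop) : prob p ≤ 1 := by
  classical
  rw [prob_eq_card_filter]
  exact div_le_one_of_le₀ (by exact_mod_cast Finset.card_le_univ _) (by positivity)

theorem prob_false {p : Ω → Prop} (h : ∀ ω, ¬ p ω) : prob p = 0 := by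
  classical
  rw [prob_eq_card_filter, Finset.filter_false_of_mem (fun ω _ => h ω)]
  simp

theorem prob_or_le (p q : Ω → Prop) : prob (fun ω => p ω ∨ q ω) ≤ prob p + prob q := by
  classical
  rw [prob_eq_card_filter, prob_eq_card_filter, prob_eq_card_filter, ← add_div,
    Finset.filter_or]
  gcongr
  exact_mod_cast Finset.card_union_le _ _

theorem prob_exists_le {ι : Type*} (s : Finset ι) (p : ι → Ω → Prop) :
    prob (fun ω => ∃ i ∈ s, p i ω) ≤ ∑ i ∈ s, prob (p i) := by
  classical
  induction s using Finset.induction_on with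
  | empty => simp [prob_false]
  | insert a s ha ih =>
    rw [Finset.sum_insert ha]
    refine le_trans (prob_mono ?_) ((prob_or_le (p a) (fun ω => ∃ i ∈ s, p i ω)).trans
      (by gcongr))
    simp

theorem one_sub_prob_le [Nonempty Ω] (p q : Ω → Prop) (h : ∀ ω, ¬ q ω → p ω) :
    1 - prob q ≤ prob p := by
  have h1 : prob (fun ω => p ω ∨ q ω) = 1 := by
    classical
    rw [prob_eq_card_filter, Finset.filter_true_of_mem
      (fun ω _ => (em (q ω)).elim Or.inr fun hq => Or.inl (h ω hq))]
    rw [Finset.card_univ, div_self]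
    exact_mod_cast Fintype.card_ne_zero
  linarith [prob_or_le p q]

theorem prob_prod_fst {Ω' : Type*} [Fintype Ω'] [Nonempty Ω'] (q : Ω → Prop) :
    prob (fun ω : Ω × Ω' => q ω.1) = prob q := by
  have e : {ω : Ω × Ω' // q ω.1} ≃ {ω // q ω} × Ω' :=
    { toFun := fun ω => (⟨ω.1.1, ω.2⟩, ω.1.2)
      invFun := fun ω => ⟨(ω.1.1, ω.2), ω.1.2⟩
      left_inv := fun _ => rfl
      right_inv := fun _ => rfl }
  have hc : (Fintype.card Ω' : ℝ) ≠ 0 := by exact_mod_cast Fintype.card_ne_zero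
  rw [prob, prob, Nat.card_congr e, Nat.card_prod, Fintype.card_prod, Nat.card_eq_fintype_card
    (α := Ω'), Nat.cast_mul, Nat.cast_mul, mul_div_mul_right _ _ hc]

end Prob

/-- The restriction of a uniformly random permutation to an embedded type `ι` is uniform among
the embeddings of `ι`. -/
theorem prob_perm_comp_embedding {ι E : Type*} [Fintype ι] [Fintype E] [DecidableEq E]
    (i : ι ↪ E) (Q : (ι ↪ E) → Prop) :
    prob (fun σ : Equiv.Perm E => Q (i.trans σ.toEmbedding)) =
      (Nat.card {g : ι ↪ E // Q g} : ℝ) / Nat.card (ι ↪ E) := by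
  classical
  let r : Equiv.Perm E → (ι ↪ E) := fun σ => i.trans σ.toEmbedding
  let c : ℕ := (Finset.univ.filter (fun σ => r σ = i)).card
  have hfib : ∀ g, (Finset.univ.filter (fun σ => r σ = g)).card = c := by
    intro g
    obtain ⟨τ, hτ⟩ := exists_perm_map_embedding i g
    symm
    refine Finset.card_bij (fun σ _ => τ * σ) ?_ ?_ ?_
    · intro σ hσ
      simp only [Finset.mem_filter, Finset.mem_univ, true_and] at hσ ⊢
      ext a
      have := DFunLike.congr_fun hσ a
      simp only [r, Function.Embedding.trans_apply, Equiv.coe_toEmbedding] at this ⊢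
      simp [this, hτ]
    · intro σ _ σ' _ h
      exact mul_left_cancel h
    · intro σ hσ
      refine ⟨τ⁻¹ * σ, ?_, by simp⟩
      simp only [Finset.mem_filter, Finset.mem_univ, true_and] at hσ ⊢
      ext a
      have := DFunLike.congr_fun hσ a
      simp only [r, Function.Embedding.trans_apply, Equiv.coe_toEmbedding] at this ⊢
      simp [this, ← hτ]
  have hcount : ∀ Q' : (ι ↪ E) → Prop, (Finset.univ.filter (fun σ => Q' (r σ))).card =
      (Finset.univ.filter Q').card * c := by
    intro Q'
    rw [Finset.card_eq_sum_card_fiberwise (f := r) (t := Finset.univ.filter Q')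
      (fun σ hσ => by simpa using hσ), Finset.sum_const_nat]
    intro g hg
    rw [← hfib g, Finset.filter_filter]
    congr 1
    ext σ
    simp only [Finset.mem_filter, Finset.mem_univ, true_and] at hg ⊢
    constructor
    · exact fun h => h.2
    · rintro rfl; exact ⟨hg, rfl⟩
  have htot := hcount (fun _ => True)
  simp only [Finset.filter_true, Finset.card_univ] at htot
  have hc : (c : ℝ) ≠ 0 := by
    have : Fintype.card (Equiv.Perm E) ≠ 0 := Fintype.card_ne_zero
    rw [htot] at this
    exact_mod_cast right_ne_zero_of_mul this
  rw [prob_eq_card_filter, hcount Q, htot, Nat.card_eq_fintype_card, Nat.card_eq_fintype_card,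
    Fintype.card_subtype, Nat.cast_mul, Nat.cast_mul, mul_div_mul_right _ _ hc]

section Edges

variable {n : ℕ}

theorem card_dEdge (n : ℕ) : Fintype.card (DEdge n) = n * (n - 1) := by
  rw [Fintype.card_subtype]
  have h := Finset.offDiag_card (Finset.univ : Finset (Fin n))
  rw [Finset.card_univ, Fintype.card_fin] at h
  rw [Nat.mul_sub, mul_one, ← h]
  congr 1
  ext e
  simp

theorem inProcess_of_le {ω : SampleSpace n} {m m' : ℕ} (h : m ≤ m') {e : DEdge n}
    (he : inProcess ω m e) : inProcess ω m' e :=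
  lt_of_lt_of_le he h

theorem inProcess_total (ω : SampleSpace n) (e : DEdge n) : inProcess ω (n * (n - 1)) e := by
  rw [← card_dEdge]
  exact Fin.is_lt _

theorem card_not_lt_position (n m : ℕ) :
    Fintype.card {e : DEdge n // ¬ ((Fintype.equivFin (DEdge n)) e).val < m} =
      n * (n - 1) - m := by
  have e : {e : DEdge n // ¬ ((Fintype.equivFin (DEdge n)) e).val < m} ≃
      {i : Fin (Fintype.card (DEdge n)) // ¬ i.val < m} :=
    (Fintype.equivFin (DEdge n)).subtypeEquiv fun _ => Iff.rfl
  rw [Fintype.card_congr e, Fintype.card_subtype, Finset.filter_not,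
    Finset.card_sdiff_of_subset (Finset.filter_subset _ _), Fin.card_filter_val_lt,
    Finset.card_univ, Fintype.card_fin, card_dEdge]
  omega

variable [Nonempty (DEdge n → Colour n)]

/-- The probability that no edge of `F` is among the first `m` edges. -/
theorem prob_forall_not_inProcess (F : Finset (DEdge n)) (m : ℕ) :
    prob (fun ω : SampleSpace n => ∀ e ∈ F, ¬ inProcess ω m e) =
      ((n * (n - 1) - m).descFactorial F.card : ℝ) / (n * (n - 1)).descFactorial F.card := by
  let i : F ↪ DEdge n := Function.Embedding.subtype _
  let P : DEdge n → Prop := fun e => ¬ ((Fintype.equivFin (DEdge n)) e).val < m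
  let Q : (F ↪ DEdge n) → Prop := fun g => ∀ a, P (g a)
  have h1 : prob (fun ω : SampleSpace n => ∀ e ∈ F, ¬ inProcess ω m e) =
      prob (fun ω : SampleSpace n => Q (i.trans ω.1.toEmbedding)) := by
    congr 1
    funext ω
    simp [Q, P, i, inProcess, edgePos]
  have e : {g // Q g} ≃ (F ↪ {e : DEdge n // P e}) :=
    { toFun := fun g => ⟨fun a => ⟨g.1 a, g.2 a⟩, fun a b h =>
        g.1.injective (congrArg Subtype.val h)⟩
      invFun := fun g => ⟨g.trans (Function.Embedding.subtype _), fun a => (g a).2⟩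
      left_inv := fun _ => rfl
      right_inv := fun _ => rfl }
  rw [h1, prob_prod_fst (fun σ : Equiv.Perm (DEdge n) => Q (i.trans σ.toEmbedding)),
    prob_perm_comp_embedding, Nat.card_congr e, Nat.card_eq_fintype_card,
    Nat.card_eq_fintype_card, Fintype.card_embedding_eq, Fintype.card_embedding_eq,
    Fintype.card_coe, card_not_lt_position, card_dEdge]

/-- The probability that all edges of `K` are among the first `m₁` edges, while no edge of `F`
is among the first `m₀` edges. -/
theorem prob_inProcess_and_not_inProcess_le {K F : Finset (DEdge n)} (hd : Disjoint K F)
    (m₀ m₁ : ℕ) :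
    prob (fun ω : SampleSpace n =>
        (∀ e ∈ K, inProcess ω m₁ e) ∧ ∀ e ∈ F, ¬ inProcess ω m₀ e) ≤
      (m₁ ^ K.card * (n * (n - 1) - m₀).descFactorial F.card : ℝ) /
        (n * (n - 1)).descFactorial (K.card + F.card) := by
  let i : (K ⊕ F) ↪ DEdge n :=
    ⟨Sum.elim Subtype.val Subtype.val, Subtype.val_injective.sumElim Subtype.val_injective
      fun a b h => Finset.disjoint_left.1 hd a.2 (h ▸ b.2)⟩
  let P : ℕ → DEdge n → Prop := fun m e => ((Fintype.equivFin (DEdge n)) e).val < m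
  let Q : ((K ⊕ F) ↪ DEdge n) → Prop := fun g =>
    (∀ a, P m₁ (g (Sum.inl a))) ∧ ∀ a, ¬ P m₀ (g (Sum.inr a))
  have h1 : prob (fun ω : SampleSpace n =>
        (∀ e ∈ K, inProcess ω m₁ e) ∧ ∀ e ∈ F, ¬ inProcess ω m₀ e) =
      prob (fun ω : SampleSpace n => Q (i.trans ω.1.toEmbedding)) := by
    congr 1
    funext ω
    simp [Q, P, i, inProcess, edgePos]
  let f : {g // Q g} → (K → Fin m₁) × (F ↪ {e : DEdge n // ¬ P m₀ e}) := fun g =>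
    (fun a => ⟨_, g.2.1 a⟩, ⟨fun a => ⟨g.1 (Sum.inr a), g.2.2 a⟩, fun a b h =>
        Sum.inr_injective (g.1.injective (congrArg Subtype.val h))⟩)
  have hf : Function.Injective f := by
    intro g g' h
    simp only [f, Prod.mk.injEq] at h
    ext1
    ext1 x
    rcases x with a | a
    · have := congrFun h.1 a
      simpa [Fin.ext_iff, ← Fin.ext_iff] using this
    · exact congrArg Subtype.val (DFunLike.congr_fun h.2 a)
  have hc : Nat.card {g // Q g} ≤ m₁ ^ K.card * (n * (n - 1) - m₀).descFactorial F.card := by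
    refine (Nat.card_le_card_of_injective f hf).trans_eq ?_
    rw [Nat.card_prod, Nat.card_fun, Nat.card_eq_fintype_card, Nat.card_eq_fintype_card,
      Nat.card_eq_fintype_card, Fintype.card_embedding_eq, Fintype.card_coe, Fintype.card_coe,
      Fintype.card_fin, card_not_lt_position]
  rw [h1, prob_prod_fst (fun σ : Equiv.Perm (DEdge n) => Q (i.trans σ.toEmbedding)),
    prob_perm_comp_embedding, Nat.card_eq_fintype_card (α := _ ↪ _),
    Fintype.card_embedding_eq, Fintype.card_sum,
    Fintype.card_coe, Fintype.card_coe, card_dEdge]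
  gcongr
  exact_mod_cast hc

end Edges

section DescFactorial

/-- A factor of the ratio of descending factorials `(N - m)_f / (N)_f`. -/
theorem sub_sub_div_sub_antitone {N m i j : ℕ} (hij : i ≤ j) (hj : j < N) :
    ((N - m - j : ℕ) : ℝ) / (N - j : ℕ) ≤ ((N - m - i : ℕ) : ℝ) / (N - i : ℕ) := by
  have h1 : (0 : ℝ) < (N - j : ℕ) := by exact_mod_cast (by omega : 0 < N - j)
  have h2 : (0 : ℝ) < (N - i : ℕ) := by exact_mod_cast (by omega : 0 < N - i)
  rcases le_or_gt (N - m) j with h | h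
  · rw [Nat.sub_eq_zero_of_le h]
    simp only [Nat.cast_zero, zero_div]
    positivity
  · rw [div_le_div_iff₀ h1 h2]
    obtain ⟨d, rfl⟩ : ∃ d, N = m + j + d := ⟨N - (m + j), by omega⟩
    obtain ⟨k, rfl⟩ : ∃ k, j = i + k := ⟨j - i, by omega⟩
    rw [show m + (i + k) + d - m - (i + k) = d by omega,
      show m + (i + k) + d - m - i = d + k by omega,
      show m + (i + k) + d - i = m + d + k by omega,
      show m + (i + k) + d - (i + k) = m + d by omega]
    push_cast
    nlinarith [mul_nonneg (Nat.cast_nonneg (α := ℝ) k) (Nat.cast_nonneg (α := ℝ) m)]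

theorem descFactorial_div_eq_prod (N m f : ℕ) :
    ((N - m).descFactorial f : ℝ) / N.descFactorial f =
      ∏ i ∈ Finset.range f, ((N - m - i : ℕ) : ℝ) / (N - i : ℕ) := by
  rw [Nat.descFactorial_eq_prod_range, Nat.descFactorial_eq_prod_range, Finset.prod_div_distrib]
  push_cast
  rfl

theorem descFactorial_div_le_exp {N m f : ℕ} (hf : f ≤ N) :
    ((N - m).descFactorial f : ℝ) / N.descFactorial f ≤ Real.exp (-(m * f / N)) := by
  rcases Nat.eq_zero_or_pos f with rfl | hf0
  · simp
  have hN : (0 : ℝ) < N := by exact_mod_cast hf0.trans_le hf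
  rw [descFactorial_div_eq_prod]
  have h : ∀ i ∈ Finset.range f, ((N - m - i : ℕ) : ℝ) / (N - i : ℕ) ≤ Real.exp (-(m / N)) := by
    intro i hi
    refine (sub_sub_div_sub_antitone (Nat.zero_le i) (by simp at hi; omega)).trans ?_
    simp only [Nat.sub_zero]
    rcases le_total m N with hm | hm
    · rw [Nat.cast_sub hm, sub_div, div_self hN.ne']
      linarith [Real.add_one_le_exp (-((m : ℝ) / N))]
    · rw [Nat.sub_eq_zero_of_le hm]
      simp [Real.exp_nonneg]
  refine (Finset.prod_le_prod (fun i _ => by positivity) h).trans_eq ?_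
  rw [Finset.prod_const, Finset.card_range, ← Real.exp_nat_mul]
  congr 1
  ring

theorem pow_le_descFactorial_div {N m f : ℕ} (hf : f < N) :
    (((N - m - f : ℕ) : ℝ) / (N - f : ℕ)) ^ f ≤
      ((N - m).descFactorial f : ℝ) / N.descFactorial f := by
  rw [descFactorial_div_eq_prod]
  calc (((N - m - f : ℕ) : ℝ) / (N - f : ℕ)) ^ f
      = ∏ i ∈ Finset.range f, ((N - m - f : ℕ) : ℝ) / (N - f : ℕ) := by
        rw [Finset.prod_const, Finset.card_range]
    _ ≤ _ := Finset.prod_le_prod (fun i _ => by positivity) fun i hi =>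
        sub_sub_div_sub_antitone (Finset.mem_range.1 hi).le hf

theorem descFactorial_two_mul_div_le_sq {N m f : ℕ} (hf : 2 * f ≤ N) :
    ((N - m).descFactorial (2 * f) : ℝ) / N.descFactorial (2 * f) ≤
      (((N - m).descFactorial f : ℝ) / N.descFactorial f) ^ 2 := by
  rw [descFactorial_div_eq_prod, descFactorial_div_eq_prod, two_mul, Finset.prod_range_add, sq]
  refine mul_le_mul_of_nonneg_left (Finset.prod_le_prod (fun i _ => by positivity)
    fun i hi => ?_) (Finset.prod_nonneg fun i _ => by positivity)
  exact sub_sub_div_sub_antitone (by omega) (by simp at hi; omega)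

/-- Splitting `(N)_{k + f}` into `(N)_f` and `k` further factors. -/
theorem mul_descFactorial_div_le {N m₀ m₁ k f : ℕ} (h : k + f < N) :
    ((m₁ : ℝ) ^ k * (N - m₀).descFactorial f) / N.descFactorial (k + f) ≤
      (m₁ / (N - f - k : ℝ)) ^ k * Real.exp (-(m₀ * f / N)) := by
  have h1 : (N - f).descFactorial k * N.descFactorial f = N.descFactorial (k + f) := by
    simpa using Nat.descFactorial_mul_descFactorial (n := N) (Nat.le_add_left f k)
  have h2 : (N - f - k : ℝ) ^ k ≤ (N - f).descFactorial k := by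
    refine le_trans ?_ (Nat.cast_le.2 (Nat.pow_sub_le_descFactorial (N - f) k))
    have : (N : ℝ) - f - k = ((N - f - k : ℕ) : ℝ) := by
      rw [Nat.sub_sub, Nat.cast_sub (by omega)]; push_cast; ring
    rw [this]
    push_cast
    gcongr
    omega
  have h3 : (0 : ℝ) < N - f - k := by
    have : ((k + f : ℕ) : ℝ) < N := by exact_mod_cast h
    push_cast at this
    linarith
  have h4 : (0 : ℝ) < N.descFactorial f := by
    exact_mod_cast Nat.descFactorial_pos.2 (by omega)
  rw [← h1, Nat.cast_mul, mul_div_mul_comm, div_pow]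
  gcongr
  exact descFactorial_div_le_exp (by omega)

end DescFactorial

section Arborescence

variable {n : ℕ}

/-- If every vertex is reachable from `v` along edges satisfying `P`, then these edges contain
a spanning arborescence rooted at `v`. -/
theorem exists_isSpanningArborescence (P : DEdge n → Prop) (v : Fin n)
    (h : ∀ w, Relation.ReflTransGen (fun x y => ∃ e : DEdge n, P e ∧ e.val = (x, y)) v w) :
    ∃ A : Set (DEdge n), (∀ e ∈ A, P e) ∧ IsSpanningArborescence A v := by
  classical
  let R : Fin n → Fin n → Prop := fun x y => ∃ e : DEdge n, P e ∧ e.val = (x, y)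
  let L : ℕ → Fin n → Prop := fun k =>
    Nat.rec (motive := fun _ => Fin n → Prop) (fun w => w = v) (fun _ ih w => ∃ u, ih u ∧ R u w) k
  have hL : ∀ w, ∃ k, L k w := by
    intro w
    induction h w with
    | refl => exact ⟨0, rfl⟩
    | tail _ hr ih => exact ih.elim fun k hk => ⟨k + 1, _, hk, hr⟩
  let d : Fin n → ℕ := fun w => Nat.find (hL w)
  have hp : ∀ w, ∃ u, w ≠ v → R u w ∧ d u < d w := by
    intro w
    by_cases hw : w = v
    · exact ⟨v, fun h => absurd hw h⟩
    have hs : L (d w) w := Nat.find_spec (hL w)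
    rcases hdw : d w with _ | k
    · rw [hdw] at hs; exact absurd hs hw
    · rw [hdw] at hs
      obtain ⟨u, hu, hr⟩ := hs
      exact ⟨u, fun _ => ⟨hr, Nat.lt_succ_of_le (Nat.find_min' (hL u) hu)⟩⟩
  choose p hp using hp
  refine ⟨{e | P e ∧ e.val.2 ≠ v ∧ e.val.1 = p e.val.2}, fun e he => he.1, fun e he => he.2.1,
    ?_, ?_⟩
  · intro w hw
    obtain ⟨e, hPe, hew⟩ := (hp w hw).1
    refine ⟨e, ⟨⟨hPe, ?_, ?_⟩, ?_⟩, ?_⟩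
    · rw [hew]; exact hw
    · rw [hew]
    · rw [hew]
    · rintro e' ⟨⟨_, _, h1⟩, h2⟩
      refine Subtype.ext ?_
      rw [hew]
      exact Prod.ext (by rw [h1, h2]) h2
  · intro w
    induction hk : d w using Nat.strong_induction_on generalizing w with
    | _ k ih =>
      by_cases hw : w = v
      · rw [hw]
      · obtain ⟨⟨e, hPe, hew⟩, hlt⟩ := hp w hw
        refine (ih _ (hk ▸ hlt) (p w) rfl).tail ⟨e, ⟨hPe, ?_, ?_⟩, hew⟩
        · rw [hew]; exact hw
        · rw [hew]

theorem ZEvent.mono {ω : SampleSpace n} {m m' : ℕ}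
    (h : ∀ e, inProcess ω m e → inProcess ω m' e) (hZ : ZEvent ω m) : ZEvent ω m' :=
  fun _ hv _ hw => hZ (fun e he => hv e (h e he)) (fun e he => hw e (h e he))

theorem AEvent.zEvent {ω : SampleSpace n} {m : ℕ} (h : AEvent ω m) : ZEvent ω m := by
  obtain ⟨u, A, hA, -, h2, -⟩ := h
  have key : ∀ v, InDegreeZero ω m v → v = u := by
    intro v hv
    by_contra hne
    obtain ⟨e, ⟨heA, hev⟩, -⟩ := h2 v hne
    exact hv e (hA e heA) hev
  exact fun v hv w hw => (key v hv).trans (key w hw).symm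

/-- The edges of the complete digraph that enter `S` from its complement. -/
def entering (S : Finset (Fin n)) : Finset (DEdge n) :=
  Finset.univ.filter fun e => e.val.1 ∉ S ∧ e.val.2 ∈ S

theorem mem_entering {S : Finset (Fin n)} {e : DEdge n} :
    e ∈ entering S ↔ e.val.1 ∉ S ∧ e.val.2 ∈ S := by
  simp [entering]

/-- All vertices of `S` except possibly one have an in-edge from within `S` in `D(n,m)`. -/
def InnerCovered (ω : SampleSpace n) (m : ℕ) (S : Finset (Fin n)) : Prop :=
  ∃ v ∈ S, ∀ w ∈ S, w ≠ v → ∃ e : DEdge n, inProcess ω m e ∧ e.val.1 ∈ S ∧ e.val.2 = w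

/-- No edge of `D(n,m)` enters `S`. -/
def Closed (ω : SampleSpace n) (m : ℕ) (S : Finset (Fin n)) : Prop :=
  ∀ e ∈ entering S, ¬ inProcess ω m e

theorem inDegreeZero_iff_closed {ω : SampleSpace n} {m : ℕ} {v : Fin n} :
    InDegreeZero ω m v ↔ Closed ω m {v} := by
  constructor
  · intro hv e he hin
    exact hv e hin (by simpa using (mem_entering.1 he).2)
  · intro h e hin hev
    refine h e (mem_entering.2 ?_) hin
    simpa [hev] using hev ▸ e.2

theorem aEvent_of_zEvent {ω : SampleSpace n} {m : ℕ} (hn : 2 ≤ n) (hZ : ZEvent ω m)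
    (hI : ∀ v, ¬ (Closed ω m {v} ∧ Closed ω m {v}ᶜ))
    (hS : ∀ S : Finset (Fin n), 2 ≤ S.card → 2 * S.card ≤ n → InnerCovered ω m S →
      ¬ Closed ω m S ∧ ¬ Closed ω m Sᶜ) :
    AEvent ω m := by
  classical
  -- a root with an out-edge such that every other vertex has an in-edge
  obtain ⟨v, hv, hout⟩ : ∃ v, (∀ w, w ≠ v → ¬ InDegreeZero ω m w) ∧ ¬ Closed ω m {v}ᶜ := by
    by_cases h0 : ∃ v, InDegreeZero ω m v
    · obtain ⟨v, hv⟩ := h0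
      exact ⟨v, fun w hw hw0 => hw (hZ hw0 hv), fun hc => hI v ⟨inDegreeZero_iff_closed.1 hv, hc⟩⟩
    · push Not at h0
      have h1 := h0 ⟨0, by omega⟩
      unfold InDegreeZero at h1
      push Not at h1
      obtain ⟨e, he, -⟩ := h1
      refine ⟨e.val.1, fun w _ => h0 w, fun hc => hc e (mem_entering.2 ?_) he⟩
      simpa using e.2.symm
  let R : Fin n → Fin n → Prop := fun x y => ∃ e : DEdge n, inProcess ω m e ∧ e.val = (x, y)
  by_cases hall : ∀ w, Relation.ReflTransGen R v w
  · obtain ⟨A, hA, hA'⟩ := exists_isSpanningArborescence (inProcess ω m) v hall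
    exact ⟨v, A, hA, hA'⟩
  exfalso
  let U : Finset (Fin n) := Finset.univ.filter fun w => Relation.ReflTransGen R v w
  have hmem : ∀ w, w ∈ U ↔ Relation.ReflTransGen R v w := fun w => by simp [U]
  have hvU : v ∈ U := (hmem v).2 .refl
  have hstep : ∀ e : DEdge n, inProcess ω m e → e.val.1 ∈ U → e.val.2 ∈ U := by
    intro e he h1
    exact (hmem _).2 (((hmem _).1 h1).tail ⟨e, he, rfl⟩)
  have hUc : Closed ω m Uᶜ := by
    intro e he hin
    have := mem_entering.1 he
    simp only [Finset.mem_compl, not_not] at this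
    exact this.2 (hstep e hin this.1)
  have hUin : InnerCovered ω m U := by
    refine ⟨v, hvU, fun w hw hwv => ?_⟩
    rcases Relation.ReflTransGen.cases_tail ((hmem w).1 hw) with h | ⟨u, hu, e, he, heu⟩
    · exact absurd h hwv
    · exact ⟨e, he, by rw [heu]; exact (hmem u).2 hu, by rw [heu]⟩
  have hU2 : 2 ≤ U.card := by
    have : ∃ e : DEdge n, e ∈ entering {v}ᶜ ∧ inProcess ω m e := by
      unfold Closed at hout
      push Not at hout
      exact hout
    obtain ⟨e, he, hin⟩ := this
    have h1 := mem_entering.1 he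
    simp only [Finset.mem_compl, Finset.mem_singleton, not_not] at h1
    exact Finset.one_lt_card.2 ⟨v, hvU, e.val.2, hstep e hin (h1.1 ▸ hvU), Ne.symm h1.2⟩
  have hcard : U.card + Uᶜ.card = n := by simp
  rcases le_or_gt (2 * U.card) n with hle | hgt
  · exact (hS U hU2 hle hUin).2 hUc
  · have hTcov : ∀ w ∈ Uᶜ, ∃ e : DEdge n, inProcess ω m e ∧ e.val.1 ∈ Uᶜ ∧ e.val.2 = w := by
      intro w hw
      have hwU : w ∉ U := by simpa using hw
      have h0 := hv w (fun h => hwU (h ▸ hvU))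
      unfold InDegreeZero at h0
      push Not at h0
      obtain ⟨e, he, hew⟩ := h0
      exact ⟨e, he, Finset.mem_compl.2 fun h => hwU (hew ▸ hstep e he h), hew⟩
    obtain ⟨w, hw⟩ : ∃ w, w ∈ Uᶜ := by
      push Not at hall
      obtain ⟨w, hw⟩ := hall
      exact ⟨w, Finset.mem_compl.2 fun h => hw ((hmem w).1 h)⟩
    have hT2 : 2 ≤ Uᶜ.card := by
      obtain ⟨e, -, h1, h2⟩ := hTcov w hw
      exact Finset.one_lt_card.2 ⟨e.val.1, h1, w, hw, fun h => e.2 (h.trans h2.symm)⟩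
    exact (hS Uᶜ hT2 (by omega) ⟨w, hw, fun x hx _ => hTcov x hx⟩).1 hUc

theorem hitTime_aEvent_eq_zEvent {ω : SampleSpace n} {m₀ m₁ : ℕ} (hn : 2 ≤ n)
    (h₀ : ¬ ZEvent ω m₀) (h₁ : ZEvent ω m₁)
    (hI : ∀ v, ¬ (Closed ω m₀ {v} ∧ Closed ω m₀ {v}ᶜ))
    (hS : ∀ S : Finset (Fin n), 2 ≤ S.card → 2 * S.card ≤ n → InnerCovered ω m₁ S →
      ¬ Closed ω m₀ S ∧ ¬ Closed ω m₀ Sᶜ) :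
    hitTime n (AEvent ω) = hitTime n (ZEvent ω) := by
  set m := hitTime n (ZEvent ω) with hm
  have hm1 : m ≤ m₁ := Nat.sInf_le (Or.inl h₁)
  have hZ : ZEvent ω m := by
    rcases Nat.sInf_mem (s := {m | ZEvent ω m} ∪ {n * (n - 1)}) ⟨_, Or.inr rfl⟩ with h | h
    · exact h
    · refine h₁.mono fun e _ => ?_
      rw [hm, hitTime, h]
      exact inProcess_total ω e
  have hm0 : m₀ ≤ m := by
    by_contra hlt
    exact h₀ (hZ.mono fun e => inProcess_of_le (by omega))
  have hcl : ∀ S, Closed ω m S → Closed ω m₀ S :=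
    fun S h e he hin => h e he (inProcess_of_le hm0 hin)
  have hA : AEvent ω m := by
    refine aEvent_of_zEvent hn hZ (fun v h => hI v ⟨hcl _ h.1, hcl _ h.2⟩) ?_
    rintro S hS2 hSn ⟨v, hv, hcov⟩
    have := hS S hS2 hSn ⟨v, hv, fun w hw hwv =>
      (hcov w hw hwv).imp fun e he => ⟨inProcess_of_le hm1 he.1, he.2⟩⟩
    exact ⟨fun h => this.1 (hcl _ h), fun h => this.2 (hcl _ h)⟩
  refine le_antisymm (Nat.sInf_le (Or.inl hA)) ?_
  rcases Nat.sInf_mem (s := {m | AEvent ω m} ∪ {n * (n - 1)}) ⟨_, Or.inr rfl⟩ with h | h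
  · exact Nat.sInf_le (Or.inl (AEvent.zEvent h))
  · rw [hitTime, h]
    exact Nat.sInf_le (Or.inr rfl)

end Arborescence

section SecondMoment

open Classical in
/-- Chebyshev's inequality: if pairwise negatively correlated events of probability `q` have an
expected number `μ > 1` of occurrences, then at most one occurs with probability at most
`μ / (μ - 1) ^ 2`. -/
theorem prob_subsingleton_le {Ω ι : Type*} [Fintype Ω] [Nonempty Ω] [Fintype ι]
    (A : ι → Ω → Prop) (q : ℝ) (hq : ∀ i, prob (A i) = q)
    (hqq : ∀ i j, i ≠ j → prob (fun ω => A i ω ∧ A j ω) ≤ q ^ 2)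
    (hμ : 1 < Fintype.card ι * q) :
    prob (fun ω => Set.Subsingleton {i | A i ω}) ≤
      Fintype.card ι * q / (Fintype.card ι * q - 1) ^ 2 := by
  set μ : ℝ := Fintype.card ι * q with hμdef
  have hc : (0 : ℝ) < Fintype.card Ω := by exact_mod_cast Fintype.card_pos
  let f : ι → Ω → ℝ := fun i ω => if A i ω then 1 else 0
  let X : Ω → ℝ := fun ω => ∑ i, f i ω
  have hprob : ∀ (p : Ω → Prop) [DecidablePred p],
      ∑ ω, (if p ω then (1 : ℝ) else 0) = prob p * Fintype.card Ω := by
    intro p _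
    rw [prob_eq_card_filter, div_mul_cancel₀ _ hc.ne']
    simp
  have hff : ∀ i j, ∑ ω, f i ω * f j ω = prob (fun ω => A i ω ∧ A j ω) * Fintype.card Ω := by
    intro i j
    rw [← hprob]
    refine Finset.sum_congr rfl fun ω _ => ?_
    by_cases h1 : A i ω <;> by_cases h2 : A j ω <;> simp [f, h1, h2]
  have hX : ∑ ω, X ω = μ * Fintype.card Ω := by
    rw [Finset.sum_comm]
    simp only [f, hprob, hq]
    simp [hμdef, mul_assoc]
  have hX2 : ∑ ω, X ω ^ 2 ≤ (μ + μ ^ 2) * Fintype.card Ω := by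
    have h1 : ∑ ω, X ω ^ 2 = ∑ i, ∑ j, prob (fun ω => A i ω ∧ A j ω) * Fintype.card Ω := by
      simp only [X, sq, Finset.sum_mul_sum]
      rw [Finset.sum_comm]
      refine Finset.sum_congr rfl fun i _ => ?_
      rw [Finset.sum_comm]
      exact Finset.sum_congr rfl fun j _ => hff i j
    have h2 : ∀ i j, prob (fun ω => A i ω ∧ A j ω) ≤ (if i = j then q else 0) + q ^ 2 := by
      intro i j
      split_ifs with h
      · subst h
        simp only [and_self, hq]
        nlinarith [sq_nonneg q]
      · simpa using hqq i j h
    rw [h1]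
    calc _ ≤ ∑ i : ι, ∑ j : ι, ((if i = j then q else 0) + q ^ 2) * Fintype.card Ω := by
          gcongr with i _ j _
          exact h2 i j
      _ = _ := by
          simp only [← Finset.sum_mul, Finset.sum_add_distrib, Finset.sum_ite_eq,
            Finset.mem_univ, if_true, Finset.sum_const, Finset.card_univ, nsmul_eq_mul, hμdef]
          ring
  have hvar : ∑ ω, (X ω - μ) ^ 2 ≤ μ * Fintype.card Ω := by
    have : ∑ ω, (X ω - μ) ^ 2 = ∑ ω, X ω ^ 2 - 2 * μ * ∑ ω, X ω + μ ^ 2 * Fintype.card Ω := by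
      rw [Finset.mul_sum, ← Finset.sum_sub_distrib]
      have : μ ^ 2 * Fintype.card Ω = ∑ _ω : Ω, μ ^ 2 := by simp [mul_comm]
      rw [this, ← Finset.sum_add_distrib]
      exact Finset.sum_congr rfl fun ω _ => by ring
    rw [this, hX]
    nlinarith
  have hle : ∀ ω, (if Set.Subsingleton {i | A i ω} then (1 : ℝ) else 0) * (μ - 1) ^ 2 ≤
      (X ω - μ) ^ 2 := by
    intro ω
    split_ifs with h
    · have hX1 : X ω ≤ 1 := by
        have : X ω = ((Finset.univ.filter fun i => A i ω).card : ℝ) := by simp [X, f]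
        rw [this]
        have h1 : (Finset.univ.filter fun i => A i ω).card ≤ 1 :=
          Finset.card_le_one.2 fun a ha b hb => h (by simpa using ha) (by simpa using hb)
        exact_mod_cast h1
      nlinarith
    · simpa using sq_nonneg _
  have hsum := Finset.sum_le_sum fun ω (_ : ω ∈ Finset.univ) => hle ω
  rw [← Finset.sum_mul, hprob] at hsum
  rw [le_div_iff₀ (by nlinarith)]
  have := hsum.trans hvar
  nlinarith

end SecondMoment

section EventBounds

variable {n : ℕ}

theorem card_entering (S : Finset (Fin n)) : (entering S).card = S.card * (n - S.card) := by
  have h : (entering S).map (Function.Embedding.subtype _) = Sᶜ ×ˢ S := by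
    ext e
    simp only [Finset.mem_map, mem_entering, Function.Embedding.subtype_apply, Finset.mem_product,
      Finset.mem_compl]
    constructor
    · rintro ⟨e', h, rfl⟩; exact h
    · intro h
      exact ⟨⟨e, fun he => h.1 (he ▸ h.2)⟩, h, rfl⟩
  rw [← Finset.card_map, h, Finset.card_product, Finset.card_compl, Fintype.card_fin, mul_comm]

theorem card_entering_compl (S : Finset (Fin n)) :
    (entering Sᶜ).card = S.card * (n - S.card) := by
  have h : S.card ≤ n := by simpa using Finset.card_le_univ S
  rw [card_entering, Finset.card_compl, Fintype.card_fin, Nat.sub_sub_self h, mul_comm]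

variable [Nonempty (DEdge n → Colour n)]

theorem prob_not_inProcess_le_exp (F : Finset (DEdge n)) (m : ℕ) :
    prob (fun ω : SampleSpace n => ∀ e ∈ F, ¬ inProcess ω m e) ≤
      Real.exp (-(m * F.card / (n * (n - 1) : ℕ))) := by
  rw [prob_forall_not_inProcess]
  exact descFactorial_div_le_exp (card_dEdge n ▸ Finset.card_le_univ F)

theorem prob_not_zEvent_le (hn : 2 ≤ n) (m : ℕ) :
    prob (fun ω : SampleSpace n => ¬ ZEvent ω m) ≤ n * Real.exp (-(m / n)) := by
  have h : ∀ ω : SampleSpace n, ¬ ZEvent ω m → ∃ v ∈ Finset.univ, Closed ω m {v} := by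
    intro ω hω
    by_contra! h
    refine hω fun v hv => ?_
    exact absurd (inDegreeZero_iff_closed.1 hv) (h v (Finset.mem_univ v))
  have hn' : ((n - 1 : ℕ) : ℝ) ≠ 0 := by exact_mod_cast (by omega : n - 1 ≠ 0)
  refine (prob_mono h).trans ((prob_exists_le _ _).trans ?_)
  calc _ ≤ ∑ v : Fin n, Real.exp (-(m / n)) := by
        refine Finset.sum_le_sum fun v _ => (prob_not_inProcess_le_exp _ _).trans_eq ?_
        rw [card_entering, Finset.card_singleton, one_mul, Nat.cast_mul,
          mul_div_mul_right _ _ hn']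
    _ = _ := by simp

theorem prob_isolated_le (hn : 2 ≤ n) (m : ℕ) :
    prob (fun ω : SampleSpace n => ∃ v : Fin n, Closed ω m {v} ∧ Closed ω m {v}ᶜ) ≤
      n * Real.exp (-(2 * (m / n))) := by
  classical
  have h : ∀ ω : SampleSpace n, (∃ v : Fin n, Closed ω m {v} ∧ Closed ω m {v}ᶜ) →
      ∃ v ∈ Finset.univ, ∀ e ∈ entering {v} ∪ entering {v}ᶜ, ¬ inProcess ω m e := by
    rintro ω ⟨v, h1, h2⟩
    exact ⟨v, Finset.mem_univ v, fun e he => (Finset.mem_union.1 he).elim (h1 e) (h2 e)⟩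
  have hn' : ((n - 1 : ℕ) : ℝ) ≠ 0 := by exact_mod_cast (by omega : n - 1 ≠ 0)
  refine (prob_mono h).trans ((prob_exists_le _ _).trans ?_)
  calc _ ≤ ∑ v : Fin n, Real.exp (-(2 * (m / n))) := by
        refine Finset.sum_le_sum fun v _ => (prob_not_inProcess_le_exp _ _).trans_eq ?_
        rw [Finset.card_union_of_disjoint, card_entering, card_entering_compl,
          Finset.card_singleton, one_mul, Nat.cast_mul, Nat.cast_add]
        · congr 2
          field_simp
          ring
        · refine Finset.disjoint_left.2 fun e he he' => ?_
          have h2 := (mem_entering.1 he').2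
          exact (Finset.mem_compl.1 h2) (mem_entering.1 he).2
    _ = _ := by simp

/-- With high probability at least two vertices have in-degree zero, as long as the expected
number `μ` of such vertices is large. -/
theorem prob_zEvent_le (hn : 3 ≤ n) (m : ℕ) (μ : ℝ)
    (hμ : μ = n * (((n * (n - 1) - m).descFactorial (n - 1) : ℝ) /
      (n * (n - 1)).descFactorial (n - 1))) (hμ1 : 1 < μ) :
    prob (fun ω : SampleSpace n => ZEvent ω m) ≤ μ / (μ - 1) ^ 2 := by
  classical
  have hZ : ∀ ω : SampleSpace n, ZEvent ω m ↔
      Set.Subsingleton {v : Fin n | Closed ω m {v}} := by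
    intro ω
    simp only [ZEvent, inDegreeZero_iff_closed]
  simp only [hZ]
  have hcard : ∀ v : Fin n, (entering {v}).card = n - 1 := fun v => by simp [card_entering]
  have := prob_subsingleton_le (fun (v : Fin n) (ω : SampleSpace n) => Closed ω m {v}) _
    (fun v => by
      have := prob_forall_not_inProcess (entering {v}) m
      rw [hcard] at this
      exact this) ?_ (by simpa [← hμ] using hμ1)
  · simpa [← hμ] using this
  · intro v w hvw
    refine le_trans (le_of_eq ?_) (descFactorial_two_mul_div_le_sq ?_)
    · have h := prob_forall_not_inProcess (entering {v} ∪ entering {w}) m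
      rw [Finset.card_union_of_disjoint, hcard, hcard, ← two_mul] at h
      · rw [← h]
        congr 1
        funext ω
        simp only [Closed, Finset.mem_union, or_imp, forall_and]
      · refine Finset.disjoint_left.2 fun e he he' => hvw ?_
        have h1 := (mem_entering.1 he).2
        have h2 := (mem_entering.1 he').2
        simp only [Finset.mem_singleton] at h1 h2
        exact h1.symm.trans h2
    · exact Nat.mul_le_mul_right _ (by omega)

theorem prob_innerCovered_and_closed_le {S T : Finset (Fin n)} (hT : T = S ∨ T = Sᶜ)
    (h2 : 2 ≤ S.card) (h2n : 2 * S.card ≤ n) (m₀ m₁ : ℕ) :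
    prob (fun ω : SampleSpace n => InnerCovered ω m₁ S ∧ Closed ω m₀ T) ≤
      S.card ^ S.card *
      ((m₁ / ((n * (n - 1) : ℕ) - (S.card * (n - S.card) : ℕ) - (S.card - 1 : ℕ) : ℝ)) ^
          (S.card - 1) *
        Real.exp (-(m₀ * (S.card * (n - S.card) : ℕ) / (n * (n - 1) : ℕ)))) := by
  classical
  have hcardT : (entering T).card = S.card * (n - S.card) := by
    rcases hT with rfl | rfl
    · exact card_entering _
    · exact card_entering_compl _
  obtain ⟨s, hs⟩ : ∃ s, s = S.card := ⟨_, rfl⟩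
  rw [← hs] at h2 h2n hcardT ⊢
  set B : ℝ := (m₁ / ((n * (n - 1) : ℕ) - (s * (n - s) : ℕ) - (s - 1 : ℕ) : ℝ)) ^ (s - 1) *
        Real.exp (-(m₀ * (s * (n - s) : ℕ) / (n * (n - 1) : ℕ))) with hB
  have hlt : s - 1 + s * (n - s) < n * (n - 1) := by
    obtain ⟨d, rfl⟩ : ∃ d, n = s + d := ⟨n - s, by omega⟩
    obtain ⟨t, ht⟩ : ∃ t, s = t + 1 := ⟨s - 1, by omega⟩
    rw [ht, show t + 1 + d - (t + 1) = d by omega, show t + 1 + d - 1 = t + d by omega,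
      show t + 1 - 1 = t by omega]
    nlinarith
  have hB0 : 0 ≤ B := by
    have : ((s - 1 + s * (n - s) : ℕ) : ℝ) < (n * (n - 1) : ℕ) := by exact_mod_cast hlt
    rw [Nat.cast_add] at this
    have : (0 : ℝ) < (n * (n - 1) : ℕ) - (s * (n - s) : ℕ) - (s - 1 : ℕ) := by linarith
    positivity
  let E : (v : Fin n) → (S.erase v → S) → SampleSpace n → Prop := fun v g ω =>
    (∀ w, ∃ h : (g w).1 ≠ w.1, inProcess ω m₁ ⟨((g w).1, w.1), h⟩) ∧ Closed ω m₀ T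
  have hE : ∀ v g, prob (E v g) ≤ B ∨ v ∉ S := by
    intro v g
    by_cases hv : v ∈ S
    swap
    · exact Or.inr hv
    left
    by_cases hg : ∀ w, (g w).1 ≠ w.1
    · let K : Finset (DEdge n) := Finset.univ.image fun w => ⟨((g w).1, w.1), hg w⟩
      have hK : K.card = s - 1 := by
        rw [Finset.card_image_of_injective, Finset.card_univ, Fintype.card_coe,
          Finset.card_erase_of_mem hv, hs]
        intro w w' h
        exact Subtype.ext (congrArg (fun e : DEdge n => e.val.2) h)
      have hd : Disjoint K (entering T) := by
        refine Finset.disjoint_left.2 fun e he he' => ?_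
        obtain ⟨w, -, rfl⟩ := Finset.mem_image.1 he
        have h1 := mem_entering.1 he'
        have h3 : w.1 ∈ S := Finset.mem_of_mem_erase w.2
        rcases hT with rfl | rfl
        · exact h1.1 (g w).2
        · exact (Finset.mem_compl.1 h1.2) h3
      refine (prob_mono ?_).trans ((prob_inProcess_and_not_inProcess_le hd m₀ m₁).trans ?_)
      · rintro ω ⟨h1, h2⟩
        refine ⟨fun e he => ?_, h2⟩
        obtain ⟨w, -, rfl⟩ := Finset.mem_image.1 he
        exact (h1 w).2
      · rw [hK, hcardT]
        exact mul_descFactorial_div_le hlt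
    · rw [prob_false]
      · exact hB0
      · exact fun ω h => hg fun w => (h.1 w).1
  have hcover : ∀ ω : SampleSpace n, InnerCovered ω m₁ S ∧ Closed ω m₀ T →
      ∃ v ∈ S, ∃ g ∈ Finset.univ, E v g ω := by
    rintro ω ⟨⟨v, hv, h⟩, hc⟩
    have : ∀ w : S.erase v, ∃ u : S, ∃ h : u.1 ≠ w.1, inProcess ω m₁ ⟨(u.1, w.1), h⟩ := by
      intro w
      obtain ⟨e, he, heS, hew⟩ := h w.1 (Finset.mem_of_mem_erase w.2) (Finset.ne_of_mem_erase w.2)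
      refine ⟨⟨e.val.1, heS⟩, hew ▸ e.2, ?_⟩
      convert he
      exact hew.symm
    choose g hg using this
    exact ⟨v, hv, g, Finset.mem_univ _, hg, hc⟩
  refine (prob_mono hcover).trans ((prob_exists_le _ _).trans ?_)
  calc _ ≤ ∑ v ∈ S, (s : ℝ) ^ (s - 1) * B := by
        refine Finset.sum_le_sum fun v hv => (prob_exists_le _ _).trans ?_
        refine (Finset.sum_le_sum fun g _ => (hE v g).resolve_right (not_not.2 hv)).trans_eq ?_
        rw [Finset.sum_const, Finset.card_univ, Fintype.card_fun, Fintype.card_coe,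
          Fintype.card_coe, Finset.card_erase_of_mem hv, ← hs, nsmul_eq_mul, Nat.cast_pow]
    _ = _ := by
        rw [Finset.sum_const, nsmul_eq_mul, ← hs, ← mul_assoc, ← pow_succ',
          Nat.sub_add_cancel (by omega)]

end EventBounds

section Asymptotics

/-- Union bound term for the vertex sets of size `s`. -/
theorem choose_mul_pow_mul_le {n s m₀ m₁ : ℕ} (hn : 40 ≤ n) (h2 : 2 ≤ s) (h2n : 2 * s ≤ n)
    (hm₀ : 0.7 * (n * Real.log n) ≤ m₀) (hm₁ : m₁ ≤ 3 * (n * Real.log n))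
    (hL : 1 ≤ Real.log n) :
    (n.choose s : ℝ) * (s ^ s *
      ((m₁ / ((n * (n - 1) : ℕ) - (s * (n - s) : ℕ) - (s - 1 : ℕ) : ℝ)) ^ (s - 1) *
        Real.exp (-(m₀ * (s * (n - s) : ℕ) / (n * (n - 1) : ℕ))))) ≤
      (6 * Real.exp 1 * Real.log n * Real.exp (-(0.1 * Real.log n))) ^ s := by
  set L := Real.log n with hLdef
  have hn0 : (0 : ℝ) < n := by exact_mod_cast (by omega : 0 < n)
  have hn40 : (40 : ℝ) ≤ n := by exact_mod_cast hn
  have hs2 : (2 : ℝ) ≤ s := by exact_mod_cast h2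
  have hsn : (2 : ℝ) * s ≤ n := by exact_mod_cast h2n
  have hexpL : Real.exp L = n := Real.exp_log hn0
  have hc1 : ((n * (n - 1) : ℕ) : ℝ) = n * (n - 1) := by
    rw [Nat.cast_mul, Nat.cast_sub (by omega), Nat.cast_one]
  have hc2 : ((s * (n - s) : ℕ) : ℝ) = s * (n - s) := by
    rw [Nat.cast_mul, Nat.cast_sub (by omega)]
  have hc3 : ((s - 1 : ℕ) : ℝ) = s - 1 := by
    rw [Nat.cast_sub (by omega), Nat.cast_one]
  rw [hc1, hc2, hc3]
  -- the base of the power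
  have hden : (n : ℝ) ^ 2 / 2 ≤ n * (n - 1) - s * (n - s) - (s - 1) := by
    nlinarith [sq_nonneg ((n : ℝ) - 2 * s)]
  have hbase : m₁ / (n * (n - 1) - s * (n - s) - (s - 1) : ℝ) ≤ 6 * L / n := by
    have h1 : (0 : ℝ) < (n : ℝ) ^ 2 / 2 := by positivity
    calc m₁ / (n * (n - 1) - s * (n - s) - (s - 1) : ℝ) ≤ (3 * (n * L)) / ((n : ℝ) ^ 2 / 2) := by
          gcongr
      _ = 6 * L / n := by field_simp; ring
  have hbase0 : 0 ≤ m₁ / (n * (n - 1) - s * (n - s) - (s - 1) : ℝ) :=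
    div_nonneg (by positivity) (le_trans (by positivity) hden)
  -- the exponent
  have hexp : -(m₀ * (s * (n - s)) / (n * (n - 1)) : ℝ) ≤ -(0.7 * L * (s * (n - s)) / n) := by
    have hns : (0 : ℝ) ≤ s * (n - s) := by nlinarith
    rw [neg_le_neg_iff, div_le_div_iff₀ hn0 (by nlinarith)]
    have h1 : 0.7 * (n * L) * (s * (n - s)) * n ≤ m₀ * (s * (n - s)) * n := by gcongr
    have h2 : 0 ≤ L * (s * (n - s)) * n := by positivity
    nlinarith
  have hquad : 1 - 0.7 * (s * (n - s)) / n ≤ -(0.1 * s : ℝ) := by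
    have h1 : (1 + 0.1 * s) * n ≤ (0.7 * (s * (n - s)) : ℝ) := by
      rcases le_or_gt (10 * (s : ℝ)) n with h | h
      · nlinarith
      · have : (5 : ℝ) ≤ s := by
          have : 40 < 10 * s := by
            have : (40 : ℝ) < ((10 * s : ℕ) : ℝ) := by push_cast; linarith
            exact_mod_cast this
          exact_mod_cast (by omega : 5 ≤ s)
        nlinarith
    have h2 := (le_div_iff₀ hn0).2 h1
    linarith
  have hchoose : (n.choose s : ℝ) * s ^ s ≤ (n * Real.exp 1) ^ s := by
    have h1 : (n.choose s : ℝ) ≤ n ^ s / s.factorial := Nat.choose_le_pow_div s n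
    have h2 : (s : ℝ) ^ s / s.factorial ≤ Real.exp s :=
      Real.pow_div_factorial_le_exp _ (by positivity) s
    calc (n.choose s : ℝ) * s ^ s ≤ n ^ s / s.factorial * s ^ s := by gcongr
      _ = n ^ s * (s ^ s / s.factorial) := by ring
      _ ≤ n ^ s * Real.exp s := by gcongr
      _ = _ := by rw [mul_pow, ← Real.exp_nat_mul, mul_one]
  have hpow : (6 * L / n) ^ (s - 1) ≤ (6 * L / n) ^ s * n := by
    have h1 : (6 * L / n) ^ s = (6 * L / n) ^ (s - 1) * (6 * L / n) := by
      rw [← pow_succ, Nat.sub_add_cancel (by omega)]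
    have h2 : (6 * L / n) ^ s * n = (6 * L / n) ^ (s - 1) * (6 * L) := by
      rw [h1]; field_simp
    rw [h2]
    exact le_mul_of_one_le_right (by positivity) (by linarith)
  calc _ = ((n.choose s : ℝ) * s ^ s) *
        ((m₁ / (n * (n - 1) - s * (n - s) - (s - 1) : ℝ)) ^ (s - 1) *
          Real.exp (-(m₀ * (s * (n - s)) / (n * (n - 1))))) := by ring
    _ ≤ (n * Real.exp 1) ^ s * (((6 * L / n) ^ s * n) *
          Real.exp (-(0.7 * L * (s * (n - s)) / n))) := by
        gcongr
        exact (pow_le_pow_left₀ hbase0 hbase _).trans hpow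
    _ = (6 * Real.exp 1 * L) ^ s * (Real.exp L * Real.exp (-(0.7 * L * (s * (n - s)) / n))) := by
        rw [hexpL, ← mul_assoc, ← mul_assoc, ← mul_pow]
        rw [show n * Real.exp 1 * (6 * L / n) = 6 * Real.exp 1 * L by field_simp]
        ring
    _ ≤ (6 * Real.exp 1 * L) ^ s * Real.exp (s * (-(0.1 * L))) := by
        rw [← Real.exp_add]
        gcongr
        have h1 : L * (1 - 0.7 * (s * (n - s)) / n) ≤ L * -(0.1 * s : ℝ) := by gcongr
        calc L + -(0.7 * L * (s * (n - s)) / n) = L * (1 - 0.7 * (s * (n - s)) / n) := by ring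
          _ ≤ _ := h1.trans_eq (by ring)
    _ = _ := by rw [mul_pow _ (Real.exp _), ← Real.exp_nat_mul]

/-- The union bound over all vertex sets. -/
theorem prob_exists_innerCovered_closed_le {n m₀ m₁ : ℕ} [Nonempty (DEdge n → Colour n)]
    (hn : 40 ≤ n) (hm₀ : 0.7 * (n * Real.log n) ≤ m₀) (hm₁ : m₁ ≤ 3 * (n * Real.log n))
    (hL : 1 ≤ Real.log n) {r : ℝ}
    (hr : r = 6 * Real.exp 1 * Real.log n * Real.exp (-(0.1 * Real.log n))) (hr2 : r ≤ 1 / 2) :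
    prob (fun ω : SampleSpace n => ∃ S : Finset (Fin n), 2 ≤ S.card ∧ 2 * S.card ≤ n ∧
      InnerCovered ω m₁ S ∧ (Closed ω m₀ S ∨ Closed ω m₀ Sᶜ)) ≤ 4 * r := by
  classical
  have hr0 : 0 ≤ r := by rw [hr]; positivity
  let b : ℕ → ℝ := fun s => if 2 ≤ s ∧ 2 * s ≤ n then 2 * (s ^ s *
      ((m₁ / ((n * (n - 1) : ℕ) - (s * (n - s) : ℕ) - (s - 1 : ℕ) : ℝ)) ^ (s - 1) *
        Real.exp (-(m₀ * (s * (n - s) : ℕ) / (n * (n - 1) : ℕ))))) else 0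
  have hS : ∀ S : Finset (Fin n), prob (fun ω : SampleSpace n => 2 ≤ S.card ∧ 2 * S.card ≤ n ∧
      InnerCovered ω m₁ S ∧ (Closed ω m₀ S ∨ Closed ω m₀ Sᶜ)) ≤ b S.card := by
    intro S
    simp only [b]
    split_ifs with h
    · refine (prob_mono (q := fun ω => (InnerCovered ω m₁ S ∧ Closed ω m₀ S) ∨
        (InnerCovered ω m₁ S ∧ Closed ω m₀ Sᶜ)) ?_).trans ((prob_or_le _ _).trans ?_)
      · rintro ω ⟨-, -, h1, h2⟩
        exact h2.imp (fun h => ⟨h1, h⟩) fun h => ⟨h1, h⟩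
      · rw [two_mul]
        exact add_le_add (prob_innerCovered_and_closed_le (Or.inl rfl) h.1 h.2 _ _)
          (prob_innerCovered_and_closed_le (Or.inr rfl) h.1 h.2 _ _)
    · exact (prob_false fun ω hω => h ⟨hω.1, hω.2.1⟩).le
  have hb : ∀ s ∈ Finset.range (n + 1), (n.choose s : ℝ) * b s ≤ 2 * if 1 ≤ s then r ^ s else 0 := by
    intro s _
    simp only [b]
    split_ifs with h h1 h1
    · have := choose_mul_pow_mul_le hn h.1 h.2 hm₀ hm₁ hL
      rw [← hr] at this
      linarith
    · omega
    · simpa using pow_nonneg hr0 s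
    · simp
  refine (prob_mono (q := fun ω : SampleSpace n => ∃ S ∈ (Finset.univ : Finset (Finset (Fin n))),
    2 ≤ S.card ∧ 2 * S.card ≤ n ∧ InnerCovered ω m₁ S ∧ (Closed ω m₀ S ∨ Closed ω m₀ Sᶜ))
    (fun ω ⟨S, h⟩ => ⟨S, Finset.mem_univ S, h⟩)).trans ((prob_exists_le _ _).trans ?_)
  calc _ ≤ ∑ S : Finset (Fin n), b S.card := Finset.sum_le_sum fun S _ => hS S
    _ = ∑ s ∈ Finset.range (n + 1), (n.choose s : ℝ) * b s := by
        rw [← Finset.powerset_univ, Finset.sum_powerset_apply_card b]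
        simp
    _ ≤ ∑ s ∈ Finset.range (n + 1), 2 * if 1 ≤ s then r ^ s else 0 := Finset.sum_le_sum hb
    _ = 2 * ∑ s ∈ Finset.Ico 1 (n + 1), r ^ s := by
        rw [← Finset.mul_sum, ← Finset.sum_filter]
        congr 2
        ext s
        simp [and_comm]
    _ ≤ 2 * (r ^ 1 / (1 - r)) := by
        gcongr
        exact geom_sum_Ico_le_of_lt_one hr0 (by linarith)
    _ ≤ 4 * r := by
        have : r ^ 1 / (1 - r) ≤ 2 * r := by
          rw [div_le_iff₀ (by linarith)]
          nlinarith
        linarith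

/-- A lower bound on the expected number of vertices of in-degree zero. -/
theorem exp_le_mul_descFactorial_div {n m : ℕ} (hn : 100 ≤ n)
    (hm : m ≤ 0.8 * (n * Real.log n)) (hL0 : 0 ≤ Real.log n) (hL : Real.log n ≤ n / 100) :
    Real.exp (0.1 * Real.log n) ≤ n * (((n * (n - 1) - m).descFactorial (n - 1) : ℝ) /
      (n * (n - 1)).descFactorial (n - 1)) := by
  set L := Real.log n with hLdef
  have hn100 : (100 : ℝ) ≤ n := by exact_mod_cast hn
  have hn0 : (0 : ℝ) < n := by linarith
  have hexpL : Real.exp L = n := Real.exp_log hn0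
  have hnat : n * (n - 1) - (n - 1) = (n - 1) * (n - 1) := by rw [Nat.sub_mul, one_mul]
  have hc : (((n - 1) * (n - 1) : ℕ) : ℝ) = (n - 1) ^ 2 := by
    rw [Nat.cast_mul, Nat.cast_sub (by omega), Nat.cast_one, sq]
  have hlow : (m : ℝ) ≤ 0.008 * n ^ 2 := by nlinarith
  have hd : (0 : ℝ) < (n - 1) ^ 2 - m := by nlinarith
  have hle : m ≤ (n - 1) * (n - 1) := by
    have : (m : ℝ) ≤ ((n - 1) * (n - 1) : ℕ) := by rw [hc]; linarith
    exact_mod_cast this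
  have hpow := pow_le_descFactorial_div (N := n * (n - 1)) (m := m) (f := n - 1)
    (lt_mul_of_one_lt_left (by omega) (by omega))
  have hfac : Real.exp (-(m / ((n - 1) ^ 2 - m))) ≤
      ((n * (n - 1) - m - (n - 1) : ℕ) : ℝ) / (n * (n - 1) - (n - 1) : ℕ) := by
    rw [Nat.sub_right_comm, hnat, Nat.cast_sub hle, hc, Real.exp_neg]
    have h1 := Real.add_one_le_exp (m / ((n - 1) ^ 2 - m) : ℝ)
    have h2 : (m / ((n - 1) ^ 2 - m) + 1 : ℝ) = (n - 1) ^ 2 / ((n - 1) ^ 2 - m) := by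
      field_simp
      ring
    rw [h2] at h1
    have h3 : (0 : ℝ) < (n - 1) ^ 2 / ((n - 1) ^ 2 - m) := by
      have : (0 : ℝ) < n - 1 := by linarith
      positivity
    calc _ ≤ ((n - 1) ^ 2 / ((n - 1) ^ 2 - m) : ℝ)⁻¹ := inv_anti₀ h3 h1
      _ = _ := inv_div _ _
  have hexp : (n - 1) * (m / ((n - 1) ^ 2 - m)) ≤ 0.9 * L := by
    rw [mul_div_assoc', div_le_iff₀ hd]
    have h1 : (n - 1) * (m : ℝ) ≤ (n - 1) * (0.8 * (n * L)) :=
      mul_le_mul_of_nonneg_left hm (by linarith)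
    have h2 : 0.9 * L * (0.992 * n ^ 2 - 2 * n + 1) ≤ 0.9 * L * ((n - 1) ^ 2 - m) := by
      refine mul_le_mul_of_nonneg_left ?_ (by linarith)
      nlinarith
    have h3 : (n - 1) * (0.8 * (n * L)) ≤ 0.9 * L * (0.992 * n ^ 2 - 2 * n + 1) := by
      have : 0 ≤ L * (0.9 * (0.992 * n ^ 2 - 2 * n + 1) - 0.8 * (n * (n - 1))) :=
        mul_nonneg hL0 (by nlinarith)
      nlinarith
    linarith
  calc Real.exp (0.1 * L) = n * Real.exp (-(0.9 * L)) := by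
        rw [← hexpL, ← Real.exp_add]; congr 1; ring
    _ ≤ n * Real.exp (-(m / ((n - 1) ^ 2 - m))) ^ (n - 1) := by
        rw [← Real.exp_nat_mul, Nat.cast_sub (by omega), Nat.cast_one]
        gcongr
        linarith
    _ ≤ _ := by
        refine mul_le_mul_of_nonneg_left (le_trans ?_ hpow) hn0.le
        exact pow_le_pow_left₀ (Real.exp_nonneg _) hfac _

theorem nonempty_colouring {n : ℕ} (hn : 3 ≤ n) : Nonempty (DEdge n → Colour n) := by
  have hn0 : (3 : ℝ) ≤ n := by exact_mod_cast hn
  have hL : 1 ≤ Real.log n := by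
    rw [Real.le_log_iff_exp_le (by linarith)]
    linarith [Real.exp_one_lt_d9]
  have heps : 0 ≤ eps n := div_nonneg (Real.log_nonneg hL) (by linarith)
  have : 0 < numColours n := Nat.floor_pos.2 (by nlinarith)
  exact ⟨fun _ => ⟨0, this⟩⟩

/-- An upper bound for the failure probability, as a function of `log n`. -/
noncomputable def failureBound (L : ℝ) : ℝ :=
  Real.exp (-L) + Real.exp (-(0.4 * L)) + 4 * Real.exp (-(0.1 * L)) +
    4 * (6 * Real.exp 1 * L * Real.exp (-(0.1 * L)))

theorem tendsto_mul_exp_neg_mul {c : ℝ} (hc : 0 < c) :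
    Tendsto (fun L : ℝ => L * Real.exp (-(c * L))) atTop (nhds 0) := by
  simpa using tendsto_rpow_mul_exp_neg_mul_atTop_nhds_zero 1 c hc

theorem tendsto_failureBound : Tendsto failureBound atTop (nhds 0) := by
  have h : ∀ c : ℝ, 0 < c → Tendsto (fun L : ℝ => Real.exp (-(c * L))) atTop (nhds 0) :=
    fun c hc => Real.tendsto_exp_neg_atTop_nhds_zero.comp (tendsto_id.const_mul_atTop hc)
  have h1 := h 1 one_pos
  have h4 := ((tendsto_mul_exp_neg_mul (c := 0.1) (by norm_num)).const_mul
    (6 * Real.exp 1)).const_mul 4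
  have := ((h1.add (h 0.4 (by norm_num))).add ((h 0.1 (by norm_num)).const_mul 4)).add h4
  simp only [mul_zero, add_zero] at this
  refine this.congr fun L => ?_
  rw [failureBound, one_mul, mul_assoc (6 * Real.exp 1)]

theorem one_sub_failureBound_le {n : ℕ} (hn : 100 ≤ n) (hL10 : 10 ≤ Real.log n)
    (hL : Real.log n ≤ n / 100)
    (hr : 6 * Real.exp 1 * Real.log n * Real.exp (-(0.1 * Real.log n)) ≤ 1 / 2) :
    1 - failureBound (Real.log n) ≤ prob (fun ω : SampleSpace n =>
      hitTime n (AEvent ω) = hitTime n (ZEvent ω)) := by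
  have := nonempty_colouring (n := n) (by omega)
  set L := Real.log n with hLdef
  have hn100 : (100 : ℝ) ≤ n := by exact_mod_cast hn
  have hn0 : (0 : ℝ) < n := by linarith
  have hexpL : Real.exp L = n := Real.exp_log hn0
  have hnL : (1000 : ℝ) ≤ n * L := by nlinarith
  set m₀ : ℕ := ⌊0.8 * (n * L)⌋₊ with hm₀
  set m₁ : ℕ := ⌈2 * (n * L)⌉₊ with hm₁
  have hm₀le : (m₀ : ℝ) ≤ 0.8 * (n * L) := Nat.floor_le (by linarith)
  have hm₀ge : 0.7 * (n * L) ≤ m₀ := by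
    have := Nat.lt_floor_add_one (0.8 * (n * L))
    rw [← hm₀] at this
    linarith
  have hm₁ge : 2 * (n * L) ≤ m₁ := Nat.le_ceil _
  have hm₁le : (m₁ : ℝ) ≤ 3 * (n * L) := by
    have := Nat.ceil_lt_add_one (a := 2 * (n * L)) (by linarith)
    linarith
  have hZ₁ : prob (fun ω : SampleSpace n => ¬ ZEvent ω m₁) ≤ Real.exp (-L) := by
    refine (prob_not_zEvent_le (by omega) m₁).trans ?_
    have h : 2 * L ≤ m₁ / n := by rw [le_div_iff₀ hn0]; linarith
    calc _ = Real.exp (L + -(m₁ / n)) := by rw [Real.exp_add, hexpL]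
      _ ≤ _ := by gcongr; linarith
  have hI : prob (fun ω : SampleSpace n => ∃ v : Fin n, Closed ω m₀ {v} ∧ Closed ω m₀ {v}ᶜ) ≤
      Real.exp (-(0.4 * L)) := by
    refine (prob_isolated_le (by omega) m₀).trans ?_
    have h : 0.7 * L ≤ m₀ / n := by rw [le_div_iff₀ hn0]; linarith
    calc _ = Real.exp (L + -(2 * (m₀ / n))) := by rw [Real.exp_add, hexpL]
      _ ≤ _ := by gcongr; linarith
  have hZ₀ : prob (fun ω : SampleSpace n => ZEvent ω m₀) ≤ 4 * Real.exp (-(0.1 * L)) := by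
    obtain ⟨μ, hμ⟩ : ∃ μ : ℝ, μ = n * (((n * (n - 1) - m₀).descFactorial (n - 1) : ℝ) /
      (n * (n - 1)).descFactorial (n - 1)) := ⟨_, rfl⟩
    have hμge : Real.exp (0.1 * L) ≤ μ := by
      rw [hμ]
      exact exp_le_mul_descFactorial_div hn hm₀le (by linarith) hL
    have h2 : 2 ≤ μ := by linarith [Real.add_one_le_exp (0.1 * L)]
    refine (prob_zEvent_le (by omega) m₀ μ hμ (by linarith)).trans ?_
    calc μ / (μ - 1) ^ 2 ≤ 4 * μ⁻¹ := by
          rw [div_le_iff₀ (by nlinarith), ← div_eq_mul_inv, div_mul_eq_mul_div,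
            le_div_iff₀ (by linarith)]
          nlinarith
      _ ≤ 4 * Real.exp (-(0.1 * L)) := by
          rw [Real.exp_neg]
          gcongr
  have hS := prob_exists_innerCovered_closed_le (m₀ := m₀) (m₁ := m₁) (by omega : 40 ≤ n)
    hm₀ge hm₁le (by linarith) rfl hr
  have : Nonempty (SampleSpace n) := inferInstance
  refine le_trans ?_ (one_sub_prob_le _ (fun ω : SampleSpace n => ((¬ ZEvent ω m₁ ∨
    ∃ v : Fin n, Closed ω m₀ {v} ∧ Closed ω m₀ {v}ᶜ) ∨ ZEvent ω m₀) ∨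
      ∃ S : Finset (Fin n), 2 ≤ S.card ∧ 2 * S.card ≤ n ∧
      InnerCovered ω m₁ S ∧ (Closed ω m₀ S ∨ Closed ω m₀ Sᶜ)) ?_)
  · have h1 := prob_or_le (fun ω : SampleSpace n => ((¬ ZEvent ω m₁ ∨
      ∃ v : Fin n, Closed ω m₀ {v} ∧ Closed ω m₀ {v}ᶜ) ∨ ZEvent ω m₀)) (fun ω =>
      ∃ S : Finset (Fin n), 2 ≤ S.card ∧ 2 * S.card ≤ n ∧
      InnerCovered ω m₁ S ∧ (Closed ω m₀ S ∨ Closed ω m₀ Sᶜ))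
    have h2 := prob_or_le (fun ω : SampleSpace n => ¬ ZEvent ω m₁ ∨
      ∃ v : Fin n, Closed ω m₀ {v} ∧ Closed ω m₀ {v}ᶜ) (fun ω => ZEvent ω m₀)
    have h3 := prob_or_le (fun ω : SampleSpace n => ¬ ZEvent ω m₁)
      (fun ω => ∃ v : Fin n, Closed ω m₀ {v} ∧ Closed ω m₀ {v}ᶜ)
    unfold failureBound
    linarith
  · intro ω hω
    push Not at hω
    obtain ⟨⟨⟨h1, h2⟩, h3⟩, h4⟩ := hω
    exact hitTime_aEvent_eq_zEvent (by omega) h3 h1 (fun v h => h2 v h.1 h.2)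
      fun S hS2 hSn hc => h4 S hS2 hSn hc

end Asymptotics

/-- A.a.s. `m_A = m_Z`: the hitting time for containing a spanning
arborescence equals the hitting time for having at most one vertex of in-degree zero. -/
theorem arborescence_hitting_time_eq_indegree_hitting_time :
    Tendsto
      (fun n : ℕ => prob (fun ω : SampleSpace n =>
        hitTime n (AEvent ω) = hitTime n (ZEvent ω)))
      atTop (nhds 1) := by
  have hlog : Tendsto (fun n : ℕ => Real.log n) atTop atTop :=
    Real.tendsto_log_atTop.comp tendsto_natCast_atTop_atTop
  have hlower : Tendsto (fun n : ℕ => 1 - failureBound (Real.log n)) atTop (nhds 1) := by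
    simpa using (tendsto_failureBound.comp hlog).const_sub 1
  have hsmall : ∀ᶠ n : ℕ in atTop, Real.log n ≤ n / 100 := by
    have h := (Real.isLittleO_log_id_atTop.comp_tendsto
      (tendsto_natCast_atTop_atTop (R := ℝ))).bound (by norm_num : (0 : ℝ) < 1 / 100)
    filter_upwards [h] with n hn
    have h1 := (le_abs_self _).trans hn
    simp only [Function.comp_apply, id, Real.norm_eq_abs, Nat.abs_cast] at h1
    linarith
  have hr : ∀ᶠ n : ℕ in atTop,
      6 * Real.exp 1 * Real.log n * Real.exp (-(0.1 * Real.log n)) ≤ 1 / 2 := by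
    have h := ((tendsto_mul_exp_neg_mul (c := 0.1) (by norm_num)).const_mul
      (6 * Real.exp 1)).comp hlog
    rw [mul_zero] at h
    filter_upwards [h.eventually_le_const (by norm_num : (0 : ℝ) < 1 / 2)] with n hn
    simpa [mul_assoc] using hn
  refine tendsto_of_tendsto_of_tendsto_of_le_of_le' hlower tendsto_const_nhds ?_
    (Eventually.of_forall fun n => prob_le_one _)
  filter_upwards [eventually_ge_atTop 100, hlog.eventually_ge_atTop 10, hsmall, hr]
    with n hn hL10 hL hr
  exact one_sub_failureBound_le hn hL10 hL hr
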